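/- Let g ≥ 2. In ℛ_g one has λ_{g−1}² = 0; moreover, if x ∈ ℛ_g is homogeneous of degree g−1 and satisfies λ_{g−1}·x = 0, then x = c·λ_{g−1} for some rational number c. -/

import Mathlib

open MvPolynomial

noncomputable section

/-- The class `λ_m` in `ℚ[λ_1, …, λ_h]`, with the conventions `λ_0 = 1` and
`λ_m = 0` for `m > h`.  Here `λ_m` for `1 ≤ m ≤ h` is the variable `X ⟨m-1⟩`. -/
def lam (h m : ℕ) : MvPolynomial (Fin h) ℚ :=
  if _h0 : m = 0 then 1
  else if _hm : m ≤ h then X ⟨m - 1, by omega⟩ else 0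

/-- The degree-`d` Mumford relation `m_d = Σ_{i+j=d} (−1)^j λ_i λ_j`. -/
def mumford (h d : ℕ) : MvPolynomial (Fin h) ℚ :=
  ∑ i ∈ Finset.range (d + 1), (-1 : MvPolynomial (Fin h) ℚ) ^ (d - i) * lam h i * lam h (d - i)

/-- The Mumford ideal `I_h`, generated by the relations `m_d` for `1 ≤ d ≤ 2h`. -/
def mumfordIdeal (h : ℕ) : Ideal (MvPolynomial (Fin h) ℚ) :=
  Ideal.span (mumford h '' Set.Icc 1 (2 * h))

/-- `𝒬_h = ℚ[λ_1,…,λ_h]/I_h`. -/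
abbrev Qring (h : ℕ) := MvPolynomial (Fin h) ℚ ⧸ mumfordIdeal h

/-- The ideal `I_g + (λ_g)`. -/
def Rideal (g : ℕ) : Ideal (MvPolynomial (Fin g) ℚ) :=
  mumfordIdeal g ⊔ Ideal.span {lam g g}

/-- `ℛ_g = ℚ[λ_1,…,λ_g]/(I_g + (λ_g))`, van der Geer's presentation of the
tautological ring `R*(𝒜_g)`. -/
abbrev Rring (g : ℕ) := MvPolynomial (Fin g) ℚ ⧸ Rideal g

/-- The degree-`k` graded piece of `ℛ_g`, for the grading with `deg λ_i = i`:
the image of the weighted-homogeneous polynomials of weighted degree `k`. -/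
def homogR (g k : ℕ) : Submodule ℚ (Rring g) :=
  Submodule.map (Ideal.Quotient.mkₐ ℚ (Rideal g)).toLinearMap
    (weightedHomogeneousSubmodule ℚ (fun i : Fin g => (i : ℕ) + 1) k)

/-- The degree-`k` graded piece of `𝒬_h`, for the grading with `deg λ_i = i`. -/
def homogQ (h k : ℕ) : Submodule ℚ (Qring h) :=
  Submodule.map (Ideal.Quotient.mkₐ ℚ (mumfordIdeal h)).toLinearMap
    (weightedHomogeneousSubmodule ℚ (fun i : Fin h => (i : ℕ) + 1) k)

/-- Polynomials all of whose monomials have `w`-weight less than `k`. -/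
def weightLT {σ R : Type*} [CommRing R] (w : σ → ℕ) (k : ℕ) : Submodule R (MvPolynomial σ R) :=
  restrictSupport R {n | Finsupp.weight w n < k}

theorem mem_weightLT {σ R : Type*} [CommRing R] {w : σ → ℕ} {k : ℕ} {f : MvPolynomial σ R} :
    f ∈ weightLT w k ↔ ∀ n ∈ f.support, Finsupp.weight w n < k :=
  Iff.rfl

theorem weightLT_mono {σ R : Type*} [CommRing R] (w : σ → ℕ) {k l : ℕ} (h : k ≤ l) :
    weightLT (R := R) w k ≤ weightLT w l :=
  fun _ hf n hn => (mem_weightLT.1 hf n hn).trans_le h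

theorem monomial_mem_weightLT {σ R : Type*} [CommRing R] (w : σ → ℕ) {k : ℕ} {n : σ →₀ ℕ}
    (h : Finsupp.weight w n < k) (r : R) : monomial n r ∈ weightLT w k := by
  refine mem_weightLT.2 fun m hm => ?_
  rwa [Finset.mem_singleton.1 (support_monomial_subset hm)]

theorem mul_mem_weightLT {σ R : Type*} [CommRing R] {w : σ → ℕ} {k l : ℕ}
    {f g : MvPolynomial σ R} (hf : f ∈ weightLT w k) (hg : g ∈ weightLT w (l + 1)) :
    f * g ∈ weightLT w (k + l) := by
  classical
  refine mem_weightLT.2 fun n hn => ?_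
  obtain ⟨a, ha, b, hb, rfl⟩ := Finset.mem_add.1 (support_mul _ _ hn)
  have h₁ := mem_weightLT.1 hf a ha
  have h₂ := mem_weightLT.1 hg b hb
  rw [map_add]
  omega

theorem eq_zero_of_mem_weightLT_zero {σ R : Type*} [CommRing R] {w : σ → ℕ}
    {f : MvPolynomial σ R} (hf : f ∈ weightLT w 0) : f = 0 := by
  rw [← support_eq_empty, Finset.eq_empty_iff_forall_notMem]
  exact fun n hn => Nat.not_lt_zero _ (mem_weightLT.1 hf n hn)

theorem exists_mem_weightLT {σ R : Type*} [CommRing R] (w : σ → ℕ) (f : MvPolynomial σ R) :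
    ∃ k, f ∈ weightLT w k :=
  ⟨f.support.sup (Finsupp.weight w) + 1,
    mem_weightLT.2 fun _ hn => Nat.lt_succ_of_le (Finset.le_sup hn)⟩

/-- `f` and `g` have `w`-weight at most `k` and agree in weight `k`. -/
structure SameLeading {σ R : Type*} [CommRing R] (w : σ → ℕ) (k : ℕ) (f g : MvPolynomial σ R) :
    Prop where
  left_mem : f ∈ weightLT w (k + 1)
  right_mem : g ∈ weightLT w (k + 1)
  sub_mem : f - g ∈ weightLT w k

namespace SameLeading

variable {σ R : Type*} [CommRing R] {w : σ → ℕ}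

theorem of_sub_mem {k : ℕ} {f g : MvPolynomial σ R} (hg : g ∈ weightLT w (k + 1))
    (h : f - g ∈ weightLT w k) : SameLeading w k f g :=
  ⟨by simpa using add_mem (weightLT_mono w k.le_succ h) hg, hg, h⟩

theorem refl {k : ℕ} {f : MvPolynomial σ R} (hf : f ∈ weightLT w (k + 1)) :
    SameLeading w k f f :=
  ⟨hf, hf, by simp⟩

theorem mul {k l : ℕ} {a b c d : MvPolynomial σ R} (h₁ : SameLeading w k a b)
    (h₂ : SameLeading w l c d) : SameLeading w (k + l) (a * c) (b * d) := by
  refine ⟨?_, ?_, ?_⟩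
  · simpa [add_right_comm] using mul_mem_weightLT h₁.left_mem h₂.left_mem
  · simpa [add_right_comm] using mul_mem_weightLT h₁.right_mem h₂.right_mem
  · rw [show a * c - b * d = (a - b) * c + (c - d) * b by ring]
    refine add_mem (mul_mem_weightLT h₁.sub_mem h₂.left_mem) ?_
    rw [add_comm k l]
    exact mul_mem_weightLT h₂.sub_mem h₁.right_mem

theorem one : SameLeading w 0 (1 : MvPolynomial σ R) 1 :=
  refl (monomial_mem_weightLT w (by simp) 1)

theorem var (i : σ) : SameLeading w (w i) (X i : MvPolynomial σ R) (X i) :=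
  refl (monomial_mem_weightLT w (by simp [Finsupp.weight_single]) 1)

theorem pow {k : ℕ} {a b : MvPolynomial σ R} (h : SameLeading w k a b) (n : ℕ) :
    SameLeading w (n * k) (a ^ n) (b ^ n) := by
  induction n with
  | zero => simpa using one
  | succ n ih => simpa [pow_succ, add_mul] using ih.mul h

theorem prod {ι : Type*} (s : Finset ι) {k : ι → ℕ} {a b : ι → MvPolynomial σ R}
    (h : ∀ i ∈ s, SameLeading w (k i) (a i) (b i)) :
    SameLeading w (∑ i ∈ s, k i) (∏ i ∈ s, a i) (∏ i ∈ s, b i) := by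
  classical
  induction s using Finset.induction_on with
  | empty => simpa using one
  | insert i s hi ih =>
    rw [Finset.sum_insert hi, Finset.prod_insert hi, Finset.prod_insert hi]
    exact (h i (Finset.mem_insert_self i s)).mul
      (ih fun j hj => h j (Finset.mem_insert_of_mem hj))

end SameLeading

/-- The monomial `X ^ n` in which each power `X i ^ e i` has been replaced by `M i`. -/
def substMonomial {σ R : Type*} [CommRing R] [Fintype σ] (M : σ → MvPolynomial σ R) (e : σ → ℕ)
    (n : σ →₀ ℕ) : MvPolynomial σ R :=
  ∏ i, (M i ^ (n i / e i) * X i ^ (n i % e i))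

/-- The linear map replacing each power `X i ^ e i` in each monomial by `M i`. -/
def substPow {σ R : Type*} [CommRing R] [Fintype σ] (M : σ → MvPolynomial σ R) (e : σ → ℕ) :
    MvPolynomial σ R →ₗ[R] MvPolynomial σ R :=
  (basisMonomials σ R).constr R (substMonomial M e)

section substPow

variable {σ R : Type*} [CommRing R] [Fintype σ] {M : σ → MvPolynomial σ R} {e : σ → ℕ}

theorem substPow_monomial (n : σ →₀ ℕ) (r : R) :
    substPow M e (monomial n r) = r • substMonomial M e n := by
  have h : substPow M e (monomial n 1) = substMonomial M e n := by
    rw [substPow, ← (basisMonomials σ R).constr_basis R (substMonomial M e) n, coe_basisMonomials]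
  rw [← h, ← map_smul, smul_monomial, smul_eq_mul, mul_one]

theorem substMonomial_add_single (he : ∀ i, 0 < e i) (i : σ) (n : σ →₀ ℕ) :
    substMonomial M e (n + Finsupp.single i (e i)) = M i * substMonomial M e n := by
  classical
  rw [substMonomial, substMonomial, ← Finset.mul_prod_erase _ _ (Finset.mem_univ i),
    ← Finset.mul_prod_erase _ _ (Finset.mem_univ i), ← mul_assoc]
  congr 1
  · simp [Nat.add_div_right _ (he i), pow_succ]
    ring
  · refine Finset.prod_congr rfl fun j hj => ?_
    simp [Finsupp.single_eq_of_ne (Finset.ne_of_mem_erase hj)]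

theorem substMonomial_add_single_one {p : σ} (hp : M p = X p ^ e p) (n : σ →₀ ℕ) :
    substMonomial M e (n + Finsupp.single p 1) = X p * substMonomial M e n := by
  classical
  rw [substMonomial, substMonomial, ← Finset.mul_prod_erase _ _ (Finset.mem_univ p),
    ← Finset.mul_prod_erase _ _ (Finset.mem_univ p), ← mul_assoc]
  congr 1
  · simp only [hp, ← pow_mul, ← pow_add, Nat.div_add_mod, ← pow_succ']
    simp
  · refine Finset.prod_congr rfl fun j hj => ?_
    simp [Finsupp.single_eq_of_ne (Finset.ne_of_mem_erase hj)]

theorem substPow_X_pow_mul (he : ∀ i, 0 < e i) (i : σ) (f : MvPolynomial σ R) :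
    substPow M e (X i ^ e i * f) = M i * substPow M e f := by
  induction f using MvPolynomial.induction_on' with
  | monomial n r =>
    rw [X_pow_eq_monomial, monomial_mul, one_mul, add_comm, substPow_monomial, substPow_monomial,
      substMonomial_add_single he, mul_smul_comm]
  | add f g hf hg => simp only [mul_add, map_add, hf, hg]

theorem substPow_X_mul {p : σ} (hp : M p = X p ^ e p) (f : MvPolynomial σ R) :
    substPow M e (X p * f) = X p * substPow M e f := by
  induction f using MvPolynomial.induction_on' with
  | monomial n r =>
    rw [X, monomial_mul, one_mul, add_comm, substPow_monomial, substPow_monomial,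
      substMonomial_add_single_one hp, mul_smul_comm, X]
  | add f g hf hg => simp only [mul_add, map_add, hf, hg]

theorem substPow_X_self_pow_mul {p : σ} (hp : M p = X p ^ e p) (k : ℕ) (f : MvPolynomial σ R) :
    substPow M e (X p ^ k * f) = X p ^ k * substPow M e f := by
  induction k with
  | zero => simp
  | succ k ih => rw [pow_succ', mul_assoc, substPow_X_mul hp, ih, mul_assoc]

variable {w : σ → ℕ}

theorem substMonomial_sameLeading (hM : ∀ i, SameLeading w (e i * w i) (M i) (X i ^ e i))
    (n : σ →₀ ℕ) :
    SameLeading w (Finsupp.weight w n) (substMonomial M e n) (monomial n 1) := by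
  have h := SameLeading.prod (w := w) Finset.univ fun i _ =>
    ((hM i).pow (n i / e i)).mul ((SameLeading.var (w := w) i).pow (n i % e i))
  have hw : ∑ i, (n i / e i * (e i * w i) + n i % e i * w i) = Finsupp.weight w n := by
    rw [Finsupp.weight_eq_sum]
    refine Finset.sum_congr rfl fun i _ => ?_
    rw [← mul_assoc, ← add_mul, Nat.div_add_mod', smul_eq_mul]
  have hX : ∏ i, ((X i ^ e i) ^ (n i / e i) * X i ^ (n i % e i)) = monomial n (1 : R) := by
    rw [monomial_eq, C_1, one_mul, Finsupp.prod_fintype _ _ (by simp)]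
    refine Finset.prod_congr rfl fun i _ => ?_
    rw [← pow_mul, ← pow_add, Nat.div_add_mod]
  rwa [hw, hX] at h

theorem substPow_sub_mem_weightLT (hM : ∀ i, SameLeading w (e i * w i) (M i) (X i ^ e i))
    {k : ℕ} {f : MvPolynomial σ R} (hf : f ∈ weightLT w (k + 1)) :
    substPow M e f - f ∈ weightLT w k := by
  have hs : substPow M e f - f =
      ∑ n ∈ f.support, coeff n f • (substMonomial M e n - monomial n 1) := by
    conv_lhs => rw [f.as_sum]
    rw [map_sum, ← Finset.sum_sub_distrib]
    refine Finset.sum_congr rfl fun n _ => ?_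
    rw [substPow_monomial, smul_sub, smul_monomial, smul_eq_mul, mul_one]
  rw [hs]
  refine sum_mem fun n hn => Submodule.smul_mem _ _ ?_
  exact weightLT_mono w (Nat.lt_succ_iff.1 (mem_weightLT.1 hf n hn))
    (substMonomial_sameLeading hM n).sub_mem

theorem substPow_injective (hM : ∀ i, SameLeading w (e i * w i) (M i) (X i ^ e i)) :
    Function.Injective (substPow M e) := by
  refine (injective_iff_map_eq_zero _).2 fun f hf => ?_
  obtain ⟨k, hk⟩ := exists_mem_weightLT w f
  induction k with
  | zero => exact eq_zero_of_mem_weightLT_zero hk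
  | succ k ih =>
    refine ih ?_
    simpa [hf] using substPow_sub_mem_weightLT hM hk

theorem substPow_surjective (hM : ∀ i, SameLeading w (e i * w i) (M i) (X i ^ e i)) :
    Function.Surjective (substPow M e) := by
  intro f
  obtain ⟨k, hk⟩ := exists_mem_weightLT w f
  induction k generalizing f with
  | zero => exact ⟨0, by rw [map_zero, eq_zero_of_mem_weightLT_zero hk]⟩
  | succ k ih =>
    obtain ⟨g, hg⟩ := ih _ (substPow_sub_mem_weightLT hM hk)
    exact ⟨f - g, by rw [map_sub, hg, sub_sub_cancel]⟩

theorem substPow_mem_span (he : ∀ i, 0 < e i) {f : MvPolynomial σ R}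
    (hf : f ∈ Ideal.span (Set.range fun i => X i ^ e i)) :
    substPow M e f ∈ Ideal.span (Set.range M) := by
  obtain ⟨q, rfl⟩ := Ideal.mem_span_range_iff_exists_fun.1 hf
  rw [map_sum]
  refine sum_mem fun i _ => ?_
  rw [mul_comm, substPow_X_pow_mul he]
  exact Ideal.mul_mem_right _ _ (Ideal.subset_span ⟨i, rfl⟩)

theorem mem_span_of_substPow_mem (he : ∀ i, 0 < e i)
    (hM : ∀ i, SameLeading w (e i * w i) (M i) (X i ^ e i)) {f : MvPolynomial σ R}
    (hf : substPow M e f ∈ Ideal.span (Set.range M)) :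
    f ∈ Ideal.span (Set.range fun i => (X i ^ e i : MvPolynomial σ R)) := by
  obtain ⟨q, hq⟩ := Ideal.mem_span_range_iff_exists_fun.1 hf
  choose r hr using fun i => substPow_surjective hM (q i)
  have : f = ∑ i, X i ^ e i * r i := by
    refine substPow_injective hM ?_
    rw [← hq, map_sum]
    refine Finset.sum_congr rfl fun i _ => ?_
    rw [substPow_X_pow_mul he, hr, mul_comm]
  rw [this]
  exact sum_mem fun i _ => Ideal.mul_mem_right _ _ (Ideal.subset_span ⟨i, rfl⟩)

end substPow

theorem mem_span_X_pow_sup_of_X_mul_mem {σ R : Type*} [CommRing R] {e : σ → ℕ} (p : σ)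
    {f : MvPolynomial σ R}
    (hf : X p * f ∈ Ideal.span (Set.range fun i => (X i ^ e i : MvPolynomial σ R))) :
    f ∈ Ideal.span (Set.range fun i => (X i ^ e i : MvPolynomial σ R)) ⊔
      Ideal.span {X p ^ (e p - 1)} := by
  classical
  have h₁ : (Set.range fun i => (X i ^ e i : MvPolynomial σ R)) =
      (fun s => monomial s (1 : R)) '' Set.range fun i => Finsupp.single i (e i) := by
    rw [← Set.range_comp]
    exact congrArg Set.range (funext fun i => X_pow_eq_monomial)
  have h₂ : ({X p ^ (e p - 1)} : Set (MvPolynomial σ R)) =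
      (fun s => monomial s (1 : R)) '' {Finsupp.single p (e p - 1)} := by
    rw [Set.image_singleton, X_pow_eq_monomial]
  rw [h₁, mem_ideal_span_monomial_image] at hf
  rw [← Ideal.span_union, h₁, h₂, ← Set.image_union, mem_ideal_span_monomial_image]
  intro n hn
  obtain ⟨_, ⟨i, rfl⟩, hi⟩ := hf (Finsupp.single p 1 + n) (by
    rw [support_X_mul]
    exact Finset.mem_map.2 ⟨n, hn, rfl⟩)
  rw [Finsupp.single_le_iff] at hi
  by_cases hip : i = p
  · subst hip
    refine ⟨_, Or.inr rfl, Finsupp.single_le_iff.2 ?_⟩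
    simp at hi
    omega
  · refine ⟨_, Or.inl ⟨i, rfl⟩, Finsupp.single_le_iff.2 ?_⟩
    simpa [Finsupp.single_eq_of_ne hip] using hi

theorem mem_span_sup_of_X_mul_mem {σ R : Type*} [CommRing R] [Fintype σ]
    {M : σ → MvPolynomial σ R} {e w : σ → ℕ} (he : ∀ i, 0 < e i)
    (hM : ∀ i, SameLeading w (e i * w i) (M i) (X i ^ e i)) {p : σ} (hp : M p = X p ^ e p)
    {f : MvPolynomial σ R} (hf : X p * f ∈ Ideal.span (Set.range M)) :
    f ∈ Ideal.span (Set.range M) ⊔ Ideal.span {X p ^ (e p - 1)} := by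
  obtain ⟨f, rfl⟩ := substPow_surjective hM f
  rw [← substPow_X_mul hp] at hf
  obtain ⟨a, ha, b, hb, rfl⟩ := Submodule.mem_sup.1
    (mem_span_X_pow_sup_of_X_mul_mem p (mem_span_of_substPow_mem he hM hf))
  obtain ⟨b, rfl⟩ := Ideal.mem_span_singleton.1 hb
  rw [map_add, substPow_X_self_pow_mul hp]
  exact Submodule.add_mem_sup (substPow_mem_span he ha)
    (Ideal.mul_mem_right _ _ (Ideal.mem_span_singleton_self _))

theorem lam_zero (h : ℕ) : lam h 0 = 1 := by
  simp [lam]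

theorem lam_succ {h : ℕ} (i : Fin h) : lam h (i + 1) = X i := by
  have : (i : ℕ) + 1 ≤ h := i.isLt
  simp [lam, this]

theorem lam_eq_zero {h m : ℕ} (hm : h < m) : lam h m = 0 := by
  simp [lam, hm.not_ge, (Nat.zero_le h).trans_lt hm |>.ne']

theorem lam_isWeightedHomogeneous (h m : ℕ) :
    IsWeightedHomogeneous (fun i : Fin h => (i : ℕ) + 1) (lam h m) m := by
  rcases m with _ | m
  · rw [lam_zero]
    exact isWeightedHomogeneous_one _ _
  · rcases le_or_gt (m + 1) h with hm | hm
    · rw [show lam h (m + 1) = X ⟨m, hm⟩ from lam_succ ⟨m, hm⟩]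
      exact isWeightedHomogeneous_X _ _ _
    · rw [lam_eq_zero hm]
      exact isWeightedHomogeneous_zero _ _ _

theorem neg_one_pow_mul_isWeightedHomogeneous {σ : Type*} {w : σ → ℕ} (k : ℕ) {d : ℕ}
    {f : MvPolynomial σ ℚ} (hf : IsWeightedHomogeneous w f d) :
    IsWeightedHomogeneous w ((-1) ^ k * f) d := by
  rw [show ((-1 : MvPolynomial σ ℚ) ^ k) = C ((-1) ^ k) by simp]
  exact hf.C_mul _

theorem mumford_isWeightedHomogeneous (h d : ℕ) :
    IsWeightedHomogeneous (fun i : Fin h => (i : ℕ) + 1) (mumford h d) d := by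
  refine IsWeightedHomogeneous.sum _ _ _ fun i hi => ?_
  rw [mul_assoc]
  have hid : i + (d - i) = d := Nat.add_sub_cancel' (Nat.lt_succ_iff.1 (Finset.mem_range.1 hi))
  refine neg_one_pow_mul_isWeightedHomogeneous _ ?_
  simpa only [hid] using (lam_isWeightedHomogeneous h i).mul (lam_isWeightedHomogeneous h (d - i))

theorem mumford_odd (h : ℕ) {d : ℕ} (hd : Odd d) : mumford h d = 0 := by
  have hneg : mumford h d = -mumford h d := by
    conv_lhs => rw [mumford, ← Finset.sum_range_reflect]
    rw [mumford, ← Finset.sum_neg_distrib]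
    refine Finset.sum_congr rfl fun i hi => ?_
    have hi : i ≤ d := Nat.lt_succ_iff.1 (Finset.mem_range.1 hi)
    have h₁ : d + 1 - 1 - i = d - i := by omega
    have h₂ : d - (d - i) = i := by omega
    rw [h₁, h₂]
    have hs : (-1 : MvPolynomial (Fin h) ℚ) ^ i = -(-1) ^ (d - i) := by
      rcases Nat.even_or_odd i with hi' | hi'
      · rw [hi'.neg_one_pow, (Nat.Odd.sub_even hi hd hi').neg_one_pow, neg_neg]
      · rw [hi'.neg_one_pow, (Nat.Odd.sub_odd hd hi').neg_one_pow]
    rw [hs]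
    ring
  exact self_eq_neg.1 hneg

theorem neg_one_pow_mul_mumford_sub_sq_mem (h d : ℕ) (S : Submodule ℚ (MvPolynomial (Fin h) ℚ))
    (hS : ∀ a b, a + b = 2 * d → a < b → lam h a * lam h b ∈ S) :
    (-1) ^ d * mumford h (2 * d) - lam h d ^ 2 ∈ S := by
  have hd : d ∈ Finset.range (2 * d + 1) := Finset.mem_range.2 (by omega)
  have hdd : 2 * d - d = d := by omega
  have hsq : (-1 : MvPolynomial (Fin h) ℚ) ^ d * (-1) ^ d = 1 := by
    rw [← mul_pow]
    simp
  rw [mumford, ← Finset.add_sum_erase _ _ hd, mul_add, hdd, mul_assoc, ← mul_assoc, hsq,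
    one_mul, ← sq, add_sub_cancel_left, Finset.mul_sum]
  refine sum_mem fun a ha => ?_
  rw [Finset.mem_erase, Finset.mem_range] at ha
  have hmem : lam h a * lam h (2 * d - a) ∈ S := by
    rcases lt_or_gt_of_ne ha.1 with hlt | hlt
    · exact hS _ _ (by omega) (by omega)
    · rw [mul_comm]
      exact hS _ _ (by omega) (by omega)
  rw [mul_assoc, ← mul_assoc, ← pow_add]
  rcases neg_one_pow_eq_or (MvPolynomial (Fin h) ℚ) (d + (2 * d - a)) with hs | hs
  · rwa [hs, one_mul]
  · rw [hs, neg_one_mul]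
    exact neg_mem hmem

theorem neg_one_pow_mul_mumford_sub_sq_mem_span {g d : ℕ} (hd : g ≤ d + 1) :
    (-1) ^ d * mumford g (2 * d) - lam g d ^ 2 ∈ Ideal.span {lam g g} := by
  refine neg_one_pow_mul_mumford_sub_sq_mem g d
    ((Ideal.span {lam g g}).restrictScalars ℚ) fun a b hab hlt => ?_
  rw [Submodule.restrictScalars_mem]
  refine Ideal.mul_mem_left _ _ ?_
  rcases (show g ≤ b by omega).eq_or_lt with rfl | hb
  · exact Ideal.mem_span_singleton_self _
  · rw [lam_eq_zero hb]
    exact zero_mem _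

/-- A weight on the variables `λ_1, …, λ_g`, concave in the index, for which the leading form of
the Mumford relation of degree `2d` is `± λ_d ^ 2`. -/
def concaveWeight (g : ℕ) (i : Fin g) : ℕ := (i + 1) * (2 * g - i)

theorem lam_mem_weightLT (g a : ℕ) :
    lam g a ∈ weightLT (concaveWeight g) (a * (2 * g + 1 - a) + 1) := by
  rcases a with _ | a
  · rw [lam_zero]
    exact monomial_mem_weightLT _ (by simp) 1
  · rcases le_or_gt (a + 1) g with ha | ha
    · rw [show lam g (a + 1) = X ⟨a, ha⟩ from lam_succ ⟨a, ha⟩]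
      refine monomial_mem_weightLT _ ?_ 1
      simp [Finsupp.weight_single, concaveWeight]
    · rw [lam_eq_zero ha]
      exact zero_mem _

theorem neg_one_pow_mul_mumford_sameLeading {g : ℕ} (i : Fin g) :
    SameLeading (concaveWeight g) (2 * concaveWeight g i)
      ((-1) ^ ((i : ℕ) + 1) * mumford g (2 * (i + 1))) (X i ^ 2) := by
  refine SameLeading.of_sub_mem ((SameLeading.var i).pow 2).left_mem ?_
  rw [← lam_succ i]
  refine neg_one_pow_mul_mumford_sub_sq_mem _ _ _ fun a b hab hlt => ?_
  rcases lt_or_ge g b with hb | hb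
  · rw [lam_eq_zero hb, mul_zero]
    exact zero_mem _
  · refine weightLT_mono _ ?_ (mul_mem_weightLT (lam_mem_weightLT g a) (lam_mem_weightLT g b))
    obtain ⟨j, hj⟩ : ∃ j, (i : ℕ) + 1 = a + j := ⟨i + 1 - a, by omega⟩
    obtain ⟨N, hN⟩ : ∃ N, 2 * g + 1 = a + 2 * j + N := ⟨2 * g + 1 - (a + 2 * j), by omega⟩
    have hj0 : 1 ≤ j := by omega
    have h₁ : 2 * g + 1 - a = 2 * j + N := by omega
    have h₂ : b = a + 2 * j := by omega
    have h₃ : 2 * g + 1 - b = N := by omega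
    have h₄ : 2 * g - i = j + N := by omega
    rw [concaveWeight, h₁, h₃, h₄, hj, h₂]
    nlinarith

/-- Generators of `Rideal g` indexed by the variables: signed Mumford relations, except that
`λ_{g-1} ^ 2` and `λ_g` are used for the last two. -/
def Rgen (g : ℕ) (i : Fin g) : MvPolynomial (Fin g) ℚ :=
  if (i : ℕ) + 1 = g then X i
  else if (i : ℕ) + 2 = g then X i ^ 2
  else (-1) ^ ((i : ℕ) + 1) * mumford g (2 * (i + 1))

/-- The exponent of the leading power of `X i` in `Rgen g i`. -/
def RgenExp (g : ℕ) (i : Fin g) : ℕ := if (i : ℕ) + 1 = g then 1 else 2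

theorem RgenExp_pos (g : ℕ) (i : Fin g) : 0 < RgenExp g i := by
  unfold RgenExp
  split_ifs <;> norm_num

theorem Rgen_sameLeading (g : ℕ) (i : Fin g) :
    SameLeading (concaveWeight g) (RgenExp g i * concaveWeight g i) (Rgen g i)
      (X i ^ RgenExp g i) := by
  unfold Rgen RgenExp
  split_ifs
  · simpa using SameLeading.var (w := concaveWeight g) i
  · exact (SameLeading.var i).pow 2
  · exact neg_one_pow_mul_mumford_sameLeading i

theorem mumford_even_mem_Rideal {g d : ℕ} (h₁ : 1 ≤ d) (h₂ : d ≤ g) :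
    mumford g (2 * d) ∈ Rideal g :=
  Ideal.mem_sup_left (Ideal.subset_span ⟨2 * d, ⟨by omega, by omega⟩, rfl⟩)

theorem lam_sq_mem_Rideal {g d : ℕ} (h₀ : 1 ≤ d) (h₁ : g ≤ d + 1) (h₂ : d ≤ g) :
    lam g d ^ 2 ∈ Rideal g := by
  have h := sub_mem (Ideal.mul_mem_left _ ((-1) ^ d) (mumford_even_mem_Rideal h₀ h₂))
    (Ideal.mem_sup_right (neg_one_pow_mul_mumford_sub_sq_mem_span h₁))
  rwa [sub_sub_cancel] at h

theorem lam_eq_Rgen {g : ℕ} {i : Fin g} (hi : (i : ℕ) + 1 = g) : lam g g = Rgen g i := by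
  rw [Rgen, if_pos hi, ← lam_succ, hi]

theorem Rideal_eq_span_Rgen {g : ℕ} (hg : 1 ≤ g) : Rideal g = Ideal.span (Set.range (Rgen g)) := by
  have hlast : lam g g ∈ Ideal.span (Set.range (Rgen g)) := by
    rw [lam_eq_Rgen (i := ⟨g - 1, by omega⟩) (Nat.sub_add_cancel hg)]
    exact Ideal.subset_span ⟨_, rfl⟩
  refine le_antisymm ?_ ?_
  · refine sup_le (Ideal.span_le.2 ?_) ((Ideal.span_singleton_le_iff_mem _).2 hlast)
    rintro _ ⟨d, ⟨hd₁, hd₂⟩, rfl⟩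
    rcases Nat.even_or_odd d with hd | hd
    · obtain ⟨d, rfl⟩ := even_iff_two_dvd.1 hd
      obtain ⟨i, rfl⟩ : ∃ i : Fin g, d = i + 1 := ⟨⟨d - 1, by omega⟩, by simp; omega⟩
      have hmem : (-1) ^ ((i : ℕ) + 1) * mumford g (2 * (i + 1)) ∈
          Ideal.span (Set.range (Rgen g)) := by
        rcases lt_or_ge ((i : ℕ) + 2) g with hi | hi
        · exact Ideal.subset_span ⟨i, by rw [Rgen, if_neg (by omega), if_neg (by omega)]⟩
        · have hsq : lam g (i + 1) ^ 2 ∈ Ideal.span (Set.range (Rgen g)) := by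
            by_cases hig : (i : ℕ) + 1 = g
            · rw [hig]
              exact Ideal.pow_mem_of_mem _ hlast 2 two_pos
            · refine Ideal.subset_span ⟨i, ?_⟩
              rw [Rgen, if_neg hig, if_pos (by omega), lam_succ]
          have h := add_mem ((Ideal.span_singleton_le_iff_mem _).2 hlast
            (neg_one_pow_mul_mumford_sub_sq_mem_span (g := g) (d := i + 1) hi)) hsq
          rwa [sub_add_cancel] at h
      exact (Ideal.unit_mul_mem_iff_mem _ (isUnit_one.neg.pow _)).1 hmem
    · rw [mumford_odd g hd]
      exact zero_mem _
  · rw [Ideal.span_le]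
    rintro _ ⟨i, rfl⟩
    by_cases h₁ : (i : ℕ) + 1 = g
    · rw [← lam_eq_Rgen h₁]
      exact Ideal.mem_sup_right (Ideal.mem_span_singleton_self _)
    · by_cases h₂ : (i : ℕ) + 2 = g
      · rw [Rgen, if_neg h₁, if_pos h₂, ← lam_succ]
        exact lam_sq_mem_Rideal (by omega) (by omega) (by omega)
      · rw [Rgen, if_neg h₁, if_neg h₂]
        exact Ideal.mul_mem_left _ _ (mumford_even_mem_Rideal (by omega) (by omega))

/-- The annihilator of `λ_{g-1}` modulo `Rideal g` is generated by `λ_{g-1}`. -/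
theorem mem_Rideal_sup_of_lam_mul_mem {g : ℕ} (hg : 2 ≤ g) {f : MvPolynomial (Fin g) ℚ}
    (hf : lam g (g - 1) * f ∈ Rideal g) : f ∈ Rideal g ⊔ Ideal.span {lam g (g - 1)} := by
  obtain ⟨p, hp⟩ : ∃ p : Fin g, (p : ℕ) + 2 = g := ⟨⟨g - 2, by omega⟩, Nat.sub_add_cancel hg⟩
  have hlam : lam g (g - 1) = X p := by rw [← lam_succ, show g - 1 = p + 1 by omega]
  have he : RgenExp g p = 2 := if_neg (by omega)
  have hgen : Rgen g p = X p ^ RgenExp g p := by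
    rw [he, Rgen, if_neg (by omega), if_pos hp]
  rw [Rideal_eq_span_Rgen (by omega), hlam] at hf ⊢
  simpa [he] using mem_span_sup_of_X_mul_mem (RgenExp_pos g) (Rgen_sameLeading g) hgen hf

theorem weightedHomogeneousComponent_mem_Rideal {g : ℕ} {f : MvPolynomial (Fin g) ℚ}
    (hf : f ∈ Rideal g) (k : ℕ) :
    weightedHomogeneousComponent (fun i : Fin g => (i : ℕ) + 1) k f ∈ Rideal g := by
  let _ := weightedGradedAlgebra ℚ fun i : Fin g => (i : ℕ) + 1
  refine weightedHomogeneousComponent_mem_of_mem ℚ _ ?_ hf k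
  rw [Rideal, mumfordIdeal, ← Ideal.span_union]
  refine Ideal.homogeneous_span _ _ ?_
  rintro _ (⟨d, -, rfl⟩ | rfl)
  · exact ⟨d, mumford_isWeightedHomogeneous g d⟩
  · exact ⟨g, lam_isWeightedHomogeneous g g⟩

theorem weightedHomogeneousComponent_mul_of_left {σ R : Type*} [CommRing R] {w : σ → ℕ} {k : ℕ}
    (hw : ∀ i, w i ≠ 0) {a : MvPolynomial σ R} (ha : IsWeightedHomogeneous w a k)
    (b : MvPolynomial σ R) :
    weightedHomogeneousComponent w k (a * b) = coeff 0 b • a := by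
  let _ := weightedGradedAlgebra R w
  have h := DirectSum.coe_decompose_mul_of_left_mem_of_le
    (weightedHomogeneousSubmodule R w) (b := b) ha le_rfl
  change ((weightedDecomposition R w).decompose' (a * b) k : MvPolynomial σ R) =
    a * ((weightedDecomposition R w).decompose' b (k - k) : MvPolynomial σ R) at h
  rw [weightedDecomposition.decompose'_apply, weightedDecomposition.decompose'_apply,
    Nat.sub_self, weightedHomogeneousComponent_zero b hw] at h
  rw [h, mul_comm, C_mul']

/-- **The annihilator of λ_{g−1} in degree g−1.**
For `g ≥ 2`, in `ℛ_g` one has `λ_{g−1}² = 0`; moreover, every homogeneous element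
`x` of degree `g−1` with `λ_{g−1} · x = 0` is a rational multiple of `λ_{g−1}`. -/
theorem Rring_lambda_g_sub_one (g : ℕ) (hg : 2 ≤ g) :
    (Ideal.Quotient.mk (Rideal g) (lam g (g - 1))) ^ 2 = 0 ∧
    (∀ x ∈ homogR g (g - 1),
      Ideal.Quotient.mk (Rideal g) (lam g (g - 1)) * x = 0 →
      ∃ c : ℚ, x = c • Ideal.Quotient.mk (Rideal g) (lam g (g - 1))) := by
  refine ⟨?_, ?_⟩
  · rw [← map_pow, Ideal.Quotient.eq_zero_iff_mem]
    exact lam_sq_mem_Rideal (by omega) (by omega) (by omega)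
  · rintro _ ⟨f, hf, rfl⟩ hx
    change Ideal.Quotient.mk (Rideal g) (lam g (g - 1)) * Ideal.Quotient.mk (Rideal g) f = 0 at hx
    rw [← map_mul, Ideal.Quotient.eq_zero_iff_mem] at hx
    obtain ⟨r, hr, q, hq, rfl⟩ := Submodule.mem_sup.1 (mem_Rideal_sup_of_lam_mul_mem hg hx)
    obtain ⟨q, rfl⟩ := Ideal.mem_span_singleton.1 hq
    refine ⟨coeff 0 q, ?_⟩
    have hcomp := IsWeightedHomogeneous.weightedHomogeneousComponent_same hf
    rw [map_add, weightedHomogeneousComponent_mul_of_left (fun i : Fin g => (i : ℕ).succ_ne_zero)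
      (lam_isWeightedHomogeneous g (g - 1))] at hcomp
    change Ideal.Quotient.mk (Rideal g) _ =
      Ideal.Quotient.mk (Rideal g) (coeff 0 q • lam g (g - 1))
    rw [Ideal.Quotient.eq, ← hcomp, add_sub_cancel_right]
    exact weightedHomogeneousComponent_mem_Rideal hr _

end
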